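/- Let (X,d) be a separable metric space directionally (ξ,η,ζ)-limited at X and endowed with an asymptotically (α,γ)-bounded Borel measure ν (α ∈ (0,1], γ ≥ 1). Let μ be a positive Borel measure on X and let q be a premeasure on closed balls satisfying C^{-1} μ(B_{αr}(x)) ≤ q(B_r(x)) ≤ C μ(B_r(x)) for some C ≥ 1, r₀ > 0, all x ∈ X and all 0 < r < r₀. Then: (1) for every Borel set A ⊂ X, (1/(γC)) μ(A) ≤ ĥμ^q(A) ≤ C inf{ μ(U) : A ⊂ U open }; (2) ĥμ^q is a countably sub-additive metric outer measure (so every Borel set is ĥμ^q-measurable); (3) if moreover μ is outer regular, then the Borel measure induced by ĥμ^q satisfies (1/(γC)) μ ≤ ĥμ^q ≤ C μ, so it is equivalent to μ. -/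

import Mathlib

open MeasureTheory Metric Set Filter Topology ENNReal Bornology

/-- `(X,d)` is directionally `(ξ,η,ζ)`-limited at `A`: for every `a ∈ A` and every
`B ⊆ A ∩ (U_ξ(a) \ {a})` such that for all distinct `b, c ∈ B` with `d(a,b) ≥ d(a,c)`,
every `x` with `d(a,x) = d(a,c)` and `d(a,x) + d(x,b) = d(a,b)` satisfies
`d(x,c)/d(a,c) ≥ η`, the set `B` has cardinality at most `ζ`. -/
def DirLimited {X : Type*} [MetricSpace X] (A : Set X) (ξ η : ℝ) (ζ : ℕ) : Prop :=
  ∀ a ∈ A, ∀ B : Set X, B ⊆ A ∩ (Metric.ball a ξ \ {a}) →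
    (∀ b ∈ B, ∀ c ∈ B, b ≠ c → dist a c ≤ dist a b →
      ∀ x : X, dist a x = dist a c → dist a x + dist x b = dist a b →
        η ≤ dist x c / dist a c) →
    B.Finite ∧ B.ncard ≤ ζ
/-- `ν` is asymptotically `(α,γ)`-bounded: finite on bounded sets, strictly positive on
balls of positive radius, and `limsup_{r→0⁺} ν(B_r(x))/ν(B_{αr}(x)) ≤ γ` for all `x`. -/
def AsympBounded {X : Type*} [MetricSpace X] [MeasurableSpace X]
    (ν : MeasureTheory.Measure X) (α γ : ℝ) : Prop :=
  (∀ s : Set X, Bornology.IsBounded s → ν s < ⊤) ∧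
  (∀ (x : X) (r : ℝ), 0 < r → 0 < ν (Metric.closedBall x r)) ∧
  (∀ x : X, Filter.limsup
      (fun r : ℝ => ν (Metric.closedBall x r) / ν (Metric.closedBall x (α * r)))
      (nhdsWithin 0 (Set.Ioi 0)) ≤ ENNReal.ofReal γ)
/-- A packing of the open set `U` of order `δ`: a countable family of pairwise disjoint
closed balls, each of positive radius at most `δ` and contained in `U`, encoded as a
countable set of (center, radius) pairs. -/
def IsPackingOf {X : Type*} [MetricSpace X] (U : Set X) (δ : ℝ) (P : Set (X × ℝ)) : Prop :=
  P.Countable ∧ (∀ p ∈ P, 0 < p.2 ∧ p.2 ≤ δ ∧ Metric.closedBall p.1 p.2 ⊆ U) ∧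
  P.Pairwise fun p p' => Disjoint (Metric.closedBall p.1 p.2) (Metric.closedBall p'.1 p'.2)

/-- `ĥμ^q_δ(U)`: supremum of `∑_{B ∈ ℱ} q(B)` over packings `ℱ` of `U` of order `δ`. -/
noncomputable def packPre {X : Type*} [MetricSpace X] (q : X → ℝ → ℝ≥0∞) (δ : ℝ)
    (U : Set X) : ℝ≥0∞ :=
  ⨆ (P : Set (X × ℝ)) (_ : IsPackingOf U δ P), ∑' p : P, q p.1.1 p.1.2

/-- `ĥμ^q(U) = inf_{δ>0} ĥμ^q_δ(U)` for `U` open. -/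
noncomputable def packOpen {X : Type*} [MetricSpace X] (q : X → ℝ → ℝ≥0∞)
    (U : Set X) : ℝ≥0∞ :=
  ⨅ (δ : ℝ) (_ : 0 < δ), packPre q δ U

/-- The packing construction extended to arbitrary sets:
`ĥμ^q(A) = inf { ĥμ^q(U) : A ⊆ U, U open }`. -/
noncomputable def packM {X : Type*} [MetricSpace X] (q : X → ℝ → ℝ≥0∞)
    (A : Set X) : ℝ≥0∞ :=
  ⨅ (U : Set X) (_ : IsOpen U) (_ : A ⊆ U), packOpen q U

/-- In a directionally limited space, the satellite configurations with centers in a set of diameter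
less than `ξ` have a bounded number of balls. -/
theorem DirLimited.hasBesicovitchCovering {X : Type*} [MetricSpace X] {ξ η : ℝ} {ζ : ℕ}
    (hη' : η ≤ 1 / 3) (h : DirLimited (univ : Set X) ξ η ζ) {S : Set X}
    (hS : ∀ x ∈ S, ∀ y ∈ S, dist x y < ξ) : HasBesicovitchCovering S := by
  refine ⟨61 * ζ + 1, 11 / 10, by norm_num, ⟨fun c => ?_⟩⟩
  set last : Fin (61 * ζ + 1).succ := Fin.last _
  set a : X := (c.c last : X)
  set ρ : ℝ := c.r last
  have hρ : 0 < ρ := c.rpos _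
  let D : Fin (61 * ζ + 1) → ℝ := fun i => dist a (c.c i.castSucc)
  let R : Fin (61 * ζ + 1) → ℝ := fun i => c.r i.castSucc
  have hR : ∀ i, 0 < R i := fun i => c.rpos _
  have hRD : ∀ i, R i ≤ D i := fun i => by
    have := (c.hlast i.castSucc (Fin.castSucc_lt_last i)).1
    rw [dist_comm] at this
    exact this
  have hρR : ∀ i, ρ ≤ 11 / 10 * R i := fun i => (c.hlast i.castSucc (Fin.castSucc_lt_last i)).2
  have hDR : ∀ i, D i ≤ R i + ρ := fun i => by
    have := c.inter i.castSucc (Fin.castSucc_lt_last i)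
    rw [dist_comm] at this
    exact this
  have hsep : ∀ i j, i ≠ j →
      (R i ≤ dist (c.c i.castSucc : X) (c.c j.castSucc) ∧ R j ≤ 11 / 10 * R i) ∨
      (R j ≤ dist (c.c i.castSucc : X) (c.c j.castSucc) ∧ R i ≤ 11 / 10 * R j) := fun i j hij => by
    have := c.h (show i.castSucc ≠ j.castSucc from fun e => hij (Fin.castSucc_injective _ e))
    simp only [dist_comm (c.c j.castSucc)] at this
    exact this
  let f : Fin (61 * ζ + 1) → ℕ := fun i => if 3 * ρ ≤ D i then 60 else ⌊D i / (ρ / 20)⌋₊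
  obtain ⟨k, -, hk⟩ := Finset.exists_lt_card_fiber_of_mul_lt_card_of_maps_to
    (s := Finset.univ) (t := Finset.range 61) (f := f) (n := ζ) (fun i _ => by
      simp only [f, Finset.mem_range]
      split_ifs with hi
      · norm_num
      · have : D i / (ρ / 20) < 60 := by
          rw [div_lt_iff₀ (by positivity)]; linarith
        have := (Nat.floor_lt' (by norm_num : (60 : ℕ) ≠ 0)).2 (by exact_mod_cast this)
        omega) (by simp)
  set T := Finset.univ.filter fun i => f i = k with hT
  have hinj : Function.Injective fun i : Fin (61 * ζ + 1) => (c.c i.castSucc : X) := by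
    intro i j hij
    by_contra hne
    have := hsep i j hne
    simp only at hij
    rw [hij, dist_self] at this
    have := hR i
    have := hR j
    rcases ‹_ ∨ _› with h | h <;> linarith [h.1]
  have key := h a (mem_univ _) ((fun i : Fin (61 * ζ + 1) => (c.c i.castSucc : X)) '' T) ?_ ?_
  · rw [ncard_image_of_injective _ hinj, ncard_coe_finset] at key
    omega
  · rintro _ ⟨i, -, rfl⟩
    refine ⟨mem_univ _, ?_, ?_⟩
    · rw [mem_ball, dist_comm]
      exact hS _ (c.c last).2 _ (c.c i.castSucc).2
    · intro e
      simp only [mem_singleton_iff] at e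
      have h1 : D i = 0 := by simp only [D]; rw [e, dist_self]
      linarith [hRD i, hR i]
  · rintro _ ⟨i, hi, rfl⟩ _ ⟨j, hj, rfl⟩ hne hle x hx hxb
    have hij : i ≠ j := fun e => hne (by rw [e])
    simp only at hle hx hxb ⊢
    have hij' := hsep i j hij
    have htri : dist (c.c i.castSucc : X) (c.c j.castSucc) ≤
      dist x (c.c i.castSucc) + dist x (c.c j.castSucc) := dist_triangle_left _ _ _
    set d := dist (c.c i.castSucc : X) (c.c j.castSucc)
    change D j ≤ D i at hle
    change dist a x = D j at hx
    change _ = D i at hxb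
    change η ≤ _ / D j
    have hDj : 0 < D j := (hR j).trans_le (hRD j)
    rw [le_div_iff₀ hDj]
    have hi' : f i = k := by simpa [hT] using hi
    have hj' : f j = k := by simpa [hT] using hj
    have hη'' : η * D j ≤ 1 / 3 * D j := by gcongr
    refine hη''.trans ?_
    have r1 := hR i
    have r2 := hR j
    have r3 := hDR i
    have r4 := hDR j
    have r5 := hRD i
    have r6 := hRD j
    have r7 := hρR i
    have r8 := hρR j
    by_cases h3 : 3 * ρ ≤ D j
    · rcases hij' with h | h <;> linarith [h.1, h.2]
    · have h4 : ¬ 3 * ρ ≤ D i := by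
        intro h4
        have e : f j = 60 := by rw [hj', ← hi']; simp [f, h4]
        simp only [f, h3, if_false] at e
        have h5 : D j / (ρ / 20) < 60 := by
          rw [div_lt_iff₀ (by positivity)]; linarith
        have := (Nat.floor_lt' (by norm_num : (60 : ℕ) ≠ 0)).2 (by exact_mod_cast h5)
        omega
      have hfl : ⌊D i / (ρ / 20)⌋₊ = ⌊D j / (ρ / 20)⌋₊ := by
        have := hi'.trans hj'.symm
        simpa only [f, h3, h4, if_false] using this
      have h6 : D i - D j ≤ ρ / 20 := by
        have e1 := Nat.lt_floor_add_one (D i / (ρ / 20))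
        have e2 := Nat.floor_le (a := D j / (ρ / 20)) (by positivity)
        rw [hfl] at e1
        have : D i / (ρ / 20) < D j / (ρ / 20) + 1 := by linarith
        rw [div_lt_iff₀ (by positivity), add_mul, div_mul_cancel₀ _ (by positivity)] at this
        linarith
      rcases hij' with h | h <;> linarith [h.1, h.2]

/-- Local Vitali covering: a Besicovitch covering by disjoint balls contained in a given open set. -/
theorem exists_disjoint_closedBall_covering_ae_subset {X : Type*} [MetricSpace X]
    [MeasurableSpace X] [BorelSpace X] [SecondCountableTopology X] (μ : Measure X) [SFinite μ]
    {S : Set X} (hSo : IsOpen S) [HasBesicovitchCovering S] {O s : Set X} (hO : IsOpen O)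
    (hOS : O ⊆ S) (hs : s ⊆ O) (f : X → Set ℝ)
    (hf : ∀ x ∈ s, ∀ δ > 0, (f x ∩ Ioo 0 δ).Nonempty) :
    ∃ P : Set (X × ℝ), P.Countable ∧
      (∀ p ∈ P, p.1 ∈ s ∧ p.2 ∈ f p.1 ∧ 0 < p.2 ∧ closedBall p.1 p.2 ⊆ O) ∧
      μ (s \ ⋃ p ∈ P, closedBall p.1 p.2) = 0 ∧
      P.Pairwise fun p p' => Disjoint (closedBall p.1 p.2) (closedBall p'.1 p'.2) := by
  obtain ⟨ν, hν, hμν, -⟩ := exists_isFiniteMeasure_absolutelyContinuous μ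
  have hemb : MeasurableEmbedding (Subtype.val : S → X) :=
    MeasurableEmbedding.subtype_coe hSo.measurableSet
  have hfin : IsFiniteMeasure (ν.comap (Subtype.val : S → X)) := by
    refine ⟨?_⟩
    rw [hemb.comap_apply]
    exact measure_lt_top _ _
  obtain ⟨t, tc, ts, tf, tν, td⟩ :=
    Besicovitch.exists_disjoint_closedBall_covering_ae_of_finiteMeasure_aux
      (ν.comap (Subtype.val : S → X)) (fun x => f x ∩ {r | 0 < r ∧ closedBall (x : X) r ⊆ O})
      (Subtype.val ⁻¹' s) (fun x hx δ hδ => by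
        obtain ⟨ε, hε, hεO⟩ := nhds_basis_closedBall.mem_iff.1 (hO.mem_nhds (hs hx))
        obtain ⟨r, hr, hr'⟩ := hf x hx (min δ ε) (lt_min hδ hε)
        exact ⟨r, ⟨hr, hr'.1, (closedBall_subset_closedBall
          (hr'.2.le.trans (min_le_right _ _))).trans hεO⟩, hr'.1, hr'.2.trans_le (min_le_left _ _)⟩)
  refine ⟨(fun p : S × ℝ => ((p.1 : X), p.2)) '' t, tc.image _, ?_, ?_, ?_⟩
  · rintro _ ⟨p, hp, rfl⟩
    exact ⟨ts p hp, (tf p hp).1, (tf p hp).2⟩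
  · apply hμν
    rw [hemb.comap_apply] at tν
    convert tν using 2
    ext x
    constructor
    · rintro ⟨hx, hx'⟩
      refine ⟨⟨x, hOS (hs hx)⟩, ⟨hx, fun h => hx' ?_⟩, rfl⟩
      simp only [mem_iUnion] at h ⊢
      obtain ⟨p, hp, hxp⟩ := h
      exact ⟨_, mem_image_of_mem _ hp, hxp⟩
    · rintro ⟨y, ⟨hy, hy'⟩, rfl⟩
      refine ⟨hy, fun h => hy' ?_⟩
      simp only [mem_iUnion] at h ⊢
      obtain ⟨_, ⟨p, hp, rfl⟩, hxp⟩ := h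
      exact ⟨p, hp, hxp⟩
  · rintro _ ⟨p, hp, rfl⟩ _ ⟨p', hp', rfl⟩ hne
    have hd : Disjoint (closedBall p.1 p.2) (closedBall p'.1 p'.2) :=
      td hp hp' (fun e => hne (by rw [e]))
    refine Set.disjoint_left.2 fun x hx hxp => ?_
    exact Set.disjoint_left.1 hd
      (show (⟨x, hOS ((tf p hp).2.2 hx)⟩ : S) ∈ closedBall p.1 p.2 from hx) hxp

/-- Global Vitali covering in a space covered by open balls, of a uniform size, which have the
Besicovitch covering property. -/
theorem exists_disjoint_closedBall_covering_ae_of_uniform {X : Type*} [MetricSpace X]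
    [MeasurableSpace X] [BorelSpace X] [SecondCountableTopology X] (μ : Measure X) [SFinite μ]
    {ε : ℝ} (hε : 0 < ε) (hX : ∀ x : X, HasBesicovitchCovering (ball x ε))
    {U s : Set X} (hU : IsOpen U) (hs : s ⊆ U) (f : X → Set ℝ)
    (hf : ∀ x ∈ s, ∀ δ > 0, (f x ∩ Ioo 0 δ).Nonempty) :
    ∃ P : Set (X × ℝ), P.Countable ∧
      (∀ p ∈ P, p.1 ∈ s ∧ p.2 ∈ f p.1 ∧ 0 < p.2 ∧ closedBall p.1 p.2 ⊆ U) ∧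
      μ (s \ ⋃ p ∈ P, closedBall p.1 p.2) = 0 ∧
      P.Pairwise fun p p' => Disjoint (closedBall p.1 p.2) (closedBall p'.1 p'.2) := by
  rcases isEmpty_or_nonempty X with hE | hE
  · exact ⟨∅, countable_empty, by simp, by simp [Set.eq_empty_of_isEmpty], by simp⟩
  have hrad : ∀ x : X, ∃ r, r ∈ Ioo 0 ε ∧ μ (sphere x r) = 0 := by
    intro x
    have hc := Measure.countable_meas_level_set_pos (μ := μ) (g := fun y => dist y x)
      (by fun_prop)
    have h1 : ¬ (Ioo 0 ε ⊆ {t : ℝ | 0 < μ {y | dist y x = t}}) := fun h =>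
      (not_le.2 hε) (Cardinal.Real.Ioo_countable_iff.1 (hc.mono h))
    obtain ⟨r, hr, hr'⟩ := not_subset.1 h1
    exact ⟨r, hr, nonpos_iff_eq_zero.1 (not_lt.1 hr')⟩
  choose r hr hr0 using hrad
  obtain ⟨t, tc, tU⟩ := countable_cover_nhds fun x : X => ball_mem_nhds x (hr x).1
  have tne : t.Nonempty := by
    by_contra h
    rw [not_nonempty_iff_eq_empty] at h
    simp only [h, mem_empty_iff_false, iUnion_of_empty, iUnion_empty] at tU
    exact empty_ne_univ tU
  obtain ⟨u, rfl⟩ := tc.exists_eq_range tne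
  let O : ℕ → Set X := fun n => (U ∩ ball (u n) (r (u n))) \
    (⋃ k ∈ Iio n, closedBall (u k) (r (u k)))
  have hOo : ∀ n, IsOpen (O n) := fun n =>
    (hU.inter isOpen_ball).sdiff ((finite_Iio n).isClosed_biUnion fun _ _ => isClosed_closedBall)
  have hOb : ∀ n, O n ⊆ ball (u n) ε := fun n x hx => ball_subset_ball (hr _).2.le hx.1.2
  have hOd : ∀ m n, m < n → Disjoint (O m) (O n) := fun m n hmn =>
    Set.disjoint_left.2 fun x hx hx' => hx'.2 <| by
      simp only [mem_iUnion]
      exact ⟨m, hmn, ball_subset_closedBall hx.1.2⟩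
  have hOd' : ∀ m n, m ≠ n → Disjoint (O m) (O n) := fun m n hmn =>
    hmn.lt_or_gt.elim (hOd m n) fun h => (hOd n m h).symm
  have hcov : U ⊆ (⋃ n, O n) ∪ ⋃ n, sphere (u n) (r (u n)) := by
    intro x hx
    by_cases hsph : x ∈ ⋃ n, sphere (u n) (r (u n))
    · exact Or.inr hsph
    left
    have hex : ∃ n, x ∈ closedBall (u n) (r (u n)) := by
      have : x ∈ ⋃ y ∈ range u, ball y (r y) := tU ▸ mem_univ x
      simp only [mem_iUnion, mem_range] at this
      obtain ⟨_, ⟨n, rfl⟩, hn⟩ := this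
      exact ⟨n, ball_subset_closedBall hn⟩
    classical
    refine mem_iUnion.2 ⟨Nat.find hex, ⟨hx, ?_⟩, ?_⟩
    · have h1 := Nat.find_spec hex
      rw [mem_ball]
      refine lt_of_le_of_ne h1 fun h2 => hsph (mem_iUnion.2 ⟨_, h2⟩)
    · simp only [mem_iUnion, mem_Iio, not_exists]
      exact fun k hk => Nat.find_min hex hk
  have hloc : ∀ n, ∃ P : Set (X × ℝ), P.Countable ∧
      (∀ p ∈ P, p.1 ∈ s ∩ O n ∧ p.2 ∈ f p.1 ∧ 0 < p.2 ∧ closedBall p.1 p.2 ⊆ O n) ∧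
      μ ((s ∩ O n) \ ⋃ p ∈ P, closedBall p.1 p.2) = 0 ∧
      P.Pairwise fun p p' => Disjoint (closedBall p.1 p.2) (closedBall p'.1 p'.2) := fun n =>
    haveI := hX (u n)
    exists_disjoint_closedBall_covering_ae_subset μ isOpen_ball (hOo n) (hOb n)
      inter_subset_right f fun x hx => hf x hx.1
  choose P hPc hP hPμ hPd using hloc
  refine ⟨⋃ n, P n, countable_iUnion hPc, ?_, ?_, ?_⟩
  · intro p hp
    obtain ⟨n, hn⟩ := mem_iUnion.1 hp
    obtain ⟨h1, h2, h3, h4⟩ := hP n p hn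
    exact ⟨h1.1, h2, h3, h4.trans fun x hx => hx.1.1⟩
  · refine measure_mono_null (t := (⋃ n, (s ∩ O n) \ ⋃ p ∈ P n, closedBall p.1 p.2) ∪
      ⋃ n, sphere (u n) (r (u n))) ?_
      (measure_union_null (measure_iUnion_null hPμ) (measure_iUnion_null fun n => hr0 _))
    rintro x ⟨hx, hx'⟩
    refine (hcov (hs hx)).imp (fun h => ?_) id
    obtain ⟨n, hn⟩ := mem_iUnion.1 h
    refine mem_iUnion.2 ⟨n, ⟨hx, hn⟩, fun h => hx' ?_⟩
    simp only [mem_iUnion] at h ⊢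
    obtain ⟨p, hp, hxp⟩ := h
    exact ⟨p, ⟨n, hp⟩, hxp⟩
  · intro p hp p' hp' hne
    obtain ⟨n, hn⟩ := mem_iUnion.1 hp
    obtain ⟨m, hm⟩ := mem_iUnion.1 hp'
    by_cases hnm : n = m
    · subst hnm
      exact hPd n hn hm hne
    · exact (hOd' n m hnm).mono (hP n p hn).2.2.2 (hP m p' hm).2.2.2

/-- If `m` decays along the scales `α ^ k` at a strictly faster geometric rate than `n`, then the
ratio `m / n` takes arbitrarily small values at arbitrarily small scales. -/
theorem exists_le_mul_of_geometric_decay {m n : ℝ → ℝ≥0∞} {α γ γ' R δ : ℝ} {ε : ℝ≥0∞}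
    (hα : 0 < α) (hα1 : α < 1) (hγ : 0 < γ) (hγ' : γ < γ') (hR : 0 < R)
    (hm : ∀ r ∈ Ioc 0 R, ENNReal.ofReal γ' * m (α * r) ≤ m r)
    (hn : ∀ r ∈ Ioc 0 R, n r ≤ ENNReal.ofReal γ * n (α * r))
    (hmR : m R ≠ ∞) (hn0 : n R ≠ 0) (hnt : n R ≠ ∞) (hε : ε ≠ 0) (hδ : 0 < δ) :
    ∃ r ∈ Ioo 0 δ, m r ≤ ε * n r := by
  have hmem : ∀ k : ℕ, α ^ k * R ∈ Ioc 0 R := fun k =>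
    ⟨by positivity, mul_le_of_le_one_left hR.le (pow_le_one₀ hα.le hα1.le)⟩
  have h1 : ∀ k : ℕ, ENNReal.ofReal γ' ^ k * m (α ^ k * R) ≤ m R := by
    intro k
    induction k with
    | zero => simp
    | succ k ih =>
      refine le_trans ?_ ih
      rw [pow_succ, mul_assoc, pow_succ' α, mul_assoc α]
      gcongr
      exact hm _ (hmem k)
  have h2 : ∀ k : ℕ, n R ≤ ENNReal.ofReal γ ^ k * n (α ^ k * R) := by
    intro k
    induction k with
    | zero => simp
    | succ k ih =>
      refine ih.trans ?_
      rw [pow_succ, mul_assoc, pow_succ' α, mul_assoc α]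
      gcongr
      exact hn _ (hmem k)
  have hγ'0 : 0 < γ' := hγ.trans hγ'
  have hratio : Tendsto (fun k : ℕ => m R * ENNReal.ofReal (γ / γ') ^ k) atTop (𝓝 0) := by
    have h3 : ENNReal.ofReal (γ / γ') < 1 := by
      rw [ENNReal.ofReal_lt_one, div_lt_one hγ'0]; exact hγ'
    simpa using ENNReal.Tendsto.const_mul (ENNReal.tendsto_pow_atTop_nhds_zero_of_lt_one h3)
      (Or.inr hmR)
  have hscale : Tendsto (fun k : ℕ => α ^ k * R) atTop (𝓝 0) := by
    simpa using (tendsto_pow_atTop_nhds_zero_of_lt_one hα.le hα1).mul_const R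
  obtain ⟨k, hk1, hk2⟩ := ((hratio.eventually_le_const (pos_iff_ne_zero.2 (mul_ne_zero hε hn0))).and
    (hscale.eventually_lt_const hδ)).exists
  refine ⟨α ^ k * R, ⟨(hmem k).1, hk2⟩, ?_⟩
  have hg0 : ENNReal.ofReal γ' ^ k ≠ 0 := pow_ne_zero _ (by simpa using hγ'0)
  have hgt : ENNReal.ofReal γ' ^ k ≠ ∞ := ENNReal.pow_ne_top ENNReal.ofReal_ne_top
  rw [← ENNReal.mul_le_mul_iff_right hg0 hgt, ← ENNReal.mul_le_mul_iff_right hn0 hnt]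
  calc n R * (ENNReal.ofReal γ' ^ k * m (α ^ k * R))
      ≤ (ENNReal.ofReal γ ^ k * n (α ^ k * R)) * m R := mul_le_mul' (h2 k) (h1 k)
    _ = (m R * ENNReal.ofReal (γ / γ') ^ k) * ENNReal.ofReal γ' ^ k * n (α ^ k * R) := by
        rw [mul_assoc (m R), ← mul_pow, ← ENNReal.ofReal_mul (by positivity),
          div_mul_cancel₀ _ hγ'0.ne']
        ring
    _ ≤ (ε * n R) * ENNReal.ofReal γ' ^ k * n (α ^ k * R) := by gcongr
    _ = n R * (ENNReal.ofReal γ' ^ k * (ε * n (α ^ k * R))) := by ring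

/-- The balls of a packing of `U` have total mass at most the mass of `U`. -/
theorem tsum_measure_closedBall_le {X : Type*} [MetricSpace X] [MeasurableSpace X] [BorelSpace X]
    (μ : Measure X) {U : Set X} {P : Set (X × ℝ)} (hP : P.Countable)
    (hPU : ∀ p ∈ P, closedBall p.1 p.2 ⊆ U)
    (hPd : P.Pairwise fun p p' => Disjoint (closedBall p.1 p.2) (closedBall p'.1 p'.2)) :
    ∑' p : P, μ (closedBall p.1.1 p.1.2) ≤ μ U := by
  rw [← measure_biUnion (μ := μ) (f := fun p : X × ℝ => closedBall p.1 p.2) hP hPd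
    fun _ _ => isClosed_closedBall.measurableSet]
  exact measure_mono (iUnion₂_subset hPU)

/-- At almost every point, a locally finite measure is not infinitesimally less doubling than an
asymptotically bounded one. -/
theorem AsympBounded.measure_not_frequently_eq_zero {X : Type*} [MetricSpace X]
    [MeasurableSpace X] [BorelSpace X] [SecondCountableTopology X] {μ ν : Measure X}
    {ε₀ α γ γ' : ℝ} (hε₀ : 0 < ε₀) (hX : ∀ x : X, HasBesicovitchCovering (ball x ε₀))
    (hα : 0 < α) (hα1 : α ≤ 1) (hγ : 1 ≤ γ) (hν : AsympBounded ν α γ) (hγ' : γ < γ')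
    {U : Set X} [SFinite (μ.restrict U)]
    (hfin : ∀ x ∈ U, ∃ R > 0, μ (closedBall x R) ≠ ∞) :
    μ.restrict U {x ∈ U | ¬ ∃ᶠ r in 𝓝[>] (0 : ℝ),
      μ (closedBall x r) ≤ ENNReal.ofReal γ' * μ (closedBall x (α * r))} = 0 := by
  set N := {x ∈ U | ¬ ∃ᶠ r in 𝓝[>] (0 : ℝ),
      μ (closedBall x r) ≤ ENNReal.ofReal γ' * μ (closedBall x (α * r))}
  obtain ⟨hν1, hν2, hν3⟩ := hν
  have hνt : ∀ x r, ν (closedBall x r) ≠ ∞ := fun x r => (hν1 _ isBounded_closedBall).ne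
  have hsmall : ∀ x ∈ N, ∀ ε : ℝ≥0∞, ε ≠ 0 → ∀ δ > 0,
      ({r | μ (closedBall x r) ≤ ε * ν (closedBall x r)} ∩ Ioo 0 δ).Nonempty := by
    rintro x ⟨hxU, hx⟩ ε hε δ hδ
    simp only [not_frequently, not_le] at hx
    rcases hα1.eq_or_lt with rfl | hα1
    · obtain ⟨r, hr⟩ := hx.exists
      rw [one_mul] at hr
      refine absurd hr (not_lt.2 (le_mul_of_one_le_left' ?_))
      rw [ENNReal.one_le_ofReal]
      linarith
    obtain ⟨γ₁, h1, h2⟩ := exists_between hγ'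
    have hev := eventually_lt_of_limsup_lt ((hν3 x).trans_lt
      ((ENNReal.ofReal_lt_ofReal_iff (by linarith)).2 h1))
    obtain ⟨R₀, hR₀, hR₀x⟩ := hfin x hxU
    obtain ⟨R, hR, hRs⟩ := (nhdsGT_basis (0 : ℝ)).eventually_iff.1 ((hx.and hev).and
      (Ioo_mem_nhdsGT hR₀))
    have hsub : ∀ r ∈ Ioc 0 (R / 2), r ∈ Ioo 0 R := fun r hr => ⟨hr.1, by linarith [hr.2]⟩
    have hR2 : (R / 2) ∈ Ioc 0 (R / 2) := ⟨by linarith, le_rfl⟩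
    obtain ⟨r, hr, hr'⟩ := exists_le_mul_of_geometric_decay (m := fun r => μ (closedBall x r))
      (n := fun r => ν (closedBall x r)) (ε := ε) (δ := δ) hα hα1 (by linarith) h2 (half_pos hR)
      (fun r hr => (hRs (hsub r hr)).1.1.le) (fun r hr => by
        have h3 := (hRs (hsub r hr)).1.2.le
        rwa [ENNReal.div_le_iff (hν2 x _ (mul_pos hα hr.1)).ne' (hνt _ _)] at h3)
      (ne_top_of_le_ne_top hR₀x (measure_mono (closedBall_subset_closedBall
        (hRs (hsub _ hR2)).2.2.le)))
      (hν2 x _ (half_pos hR)).ne' (hνt _ _) hε hδ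
    exact ⟨r, hr', hr⟩
  refine measure_null_of_locally_null _ fun x hx => ⟨N ∩ ball x 1,
    inter_mem_nhdsWithin _ (ball_mem_nhds _ one_pos), ?_⟩
  have hle : ∀ ε : ℝ≥0∞, ε ≠ 0 → μ.restrict U (N ∩ ball x 1) ≤ ε * ν (ball x 1) := by
    intro ε hε
    obtain ⟨P, hPc, hP, hP0, hPd⟩ := exists_disjoint_closedBall_covering_ae_of_uniform
      (μ.restrict U) hε₀ hX (isOpen_ball (x := x) (ε := 1)) (s := N ∩ ball x 1) inter_subset_right
      (fun y => {r | μ (closedBall y r) ≤ ε * ν (closedBall y r)})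
      (fun y hy => hsmall y hy.1 ε hε)
    calc μ.restrict U (N ∩ ball x 1)
        ≤ μ.restrict U (⋃ p ∈ P, closedBall p.1 p.2) := measure_mono_ae (by
          rwa [ae_le_set])
      _ ≤ ∑' p : P, μ.restrict U (closedBall p.1.1 p.1.2) := measure_biUnion_le _ hPc _
      _ ≤ ∑' p : P, ε * ν (closedBall p.1.1 p.1.2) := ENNReal.tsum_le_tsum fun p =>
          (Measure.restrict_apply_le _ _).trans (hP p p.2).2.1
      _ = ε * ∑' p : P, ν (closedBall p.1.1 p.1.2) := ENNReal.tsum_mul_left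
      _ ≤ ε * ν (ball x 1) := by
          gcongr
          exact tsum_measure_closedBall_le ν hPc (fun p hp => (hP p hp).2.2.2) hPd
  have hb : ν (ball x 1) ≠ ∞ := (hν1 _ isBounded_ball).ne
  refine nonpos_iff_eq_zero.1 (ge_of_tendsto (x := 𝓝[>] (0 : ℝ≥0∞))
    (f := fun ε => ε * ν (ball x 1)) ?_ ?_)
  · have : Tendsto (fun ε => ε * ν (ball x 1)) (𝓝 (0 : ℝ≥0∞)) (𝓝 (0 * ν (ball x 1))) :=
      ENNReal.Tendsto.mul_const tendsto_id (Or.inr hb)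
    rw [zero_mul] at this
    exact this.mono_left nhdsWithin_le_nhds
  · filter_upwards [self_mem_nhdsWithin] with ε hε
    exact hle ε (ne_of_gt hε)

/-- A measure which is locally finite at the points of `U` is s-finite on `U`. -/
theorem sFinite_restrict_of_locally_finite {X : Type*} [MetricSpace X] [MeasurableSpace X]
    [BorelSpace X] [SecondCountableTopology X] {μ : Measure X} {U : Set X}
    (hfin : ∀ x ∈ U, ∃ R > 0, μ (closedBall x R) ≠ ∞) : SFinite (μ.restrict U) := by
  choose! R hR hRμ using hfin
  obtain ⟨t, htU, tc, ht⟩ := TopologicalSpace.countable_cover_nhdsWithin (s := U)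
    (f := fun x => closedBall x (R x)) fun x hx =>
      mem_nhdsWithin_of_mem_nhds (closedBall_mem_nhds x (hR x hx))
  have : Countable t := tc.to_subtype
  have hs : SFinite (Measure.sum fun x : t => μ.restrict (closedBall x (R x))) := by
    have : ∀ x : t, IsFiniteMeasure (μ.restrict (closedBall (x : X) (R x))) := fun x =>
      ⟨by rw [Measure.restrict_apply_univ]; exact (hRμ x (htU x.2)).lt_top⟩
    infer_instance
  have h1 : μ.restrict U ≤ Measure.sum fun x : t => μ.restrict (closedBall (x : X) (R x)) := by
    refine (Measure.restrict_mono_set μ ht).trans ?_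
    rw [biUnion_eq_iUnion]
    exact Measure.restrict_iUnion_le
  exact sFinite_of_absolutelyContinuous (Measure.absolutelyContinuous_of_le h1)

/-- Lower bound for the packing premeasure of an open set. -/
theorem ofReal_mul_measure_le_packPre {X : Type*} [MetricSpace X] [MeasurableSpace X]
    [BorelSpace X] [SecondCountableTopology X] {μ ν : Measure X}
    {ε₀ α γ C r₀ : ℝ} (hε₀ : 0 < ε₀) (hX : ∀ x : X, HasBesicovitchCovering (ball x ε₀))
    (hα : 0 < α) (hα1 : α ≤ 1) (hγ : 1 ≤ γ) (hν : AsympBounded ν α γ)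
    {q : X → ℝ → ℝ≥0∞} (hC : 1 ≤ C) (hr₀ : 0 < r₀)
    (hq₁ : ∀ (x : X) (r : ℝ), 0 < r → r < r₀ →
      ENNReal.ofReal (1 / C) * μ (closedBall x (α * r)) ≤ q x r)
    {U : Set X} (hU : IsOpen U) {δ : ℝ} (hδ : 0 < δ) :
    ENNReal.ofReal (1 / (γ * C)) * μ U ≤ packPre q δ U := by
  have hC0 : 0 < C := by linarith
  by_cases hfin : ∀ x ∈ U, ∃ R > 0, μ (closedBall x R) ≠ ∞
  · have := sFinite_restrict_of_locally_finite hfin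
    have hle : ∀ γ' > γ, ENNReal.ofReal (1 / (γ' * C)) * μ U ≤ packPre q δ U := by
      intro γ' hγ'
      have hγ'0 : 0 < γ' := by linarith
      have hnull := hν.measure_not_frequently_eq_zero hε₀ hX hα hα1 hγ hγ' hfin
      set s := {x ∈ U | ∃ᶠ r in 𝓝[>] (0 : ℝ),
        μ (closedBall x r) ≤ ENNReal.ofReal γ' * μ (closedBall x (α * r))}
      obtain ⟨P, hPc, hP, hP0, hPd⟩ := exists_disjoint_closedBall_covering_ae_of_uniform
        (μ.restrict U) hε₀ hX hU (s := s) (sep_subset _ _)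
        (fun x => {r | μ (closedBall x r) ≤ ENNReal.ofReal γ' * μ (closedBall x (α * r))} ∩
          Ioo 0 (min δ r₀)) (fun x hx η hη => by
            obtain ⟨r, hr, hr'⟩ := (hx.2.and_eventually
              (Ioo_mem_nhdsGT (lt_min (lt_min hδ hr₀) hη))).exists
            exact ⟨r, ⟨hr, hr'.1, hr'.2.trans_le (min_le_left _ _)⟩, hr'.1,
              hr'.2.trans_le (min_le_right _ _)⟩)
      have hPq : ∑' p : P, q p.1.1 p.1.2 ≤ packPre q δ U :=
        le_iSup₂_of_le (f := fun (P : Set (X × ℝ)) (_ : IsPackingOf U δ P) =>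
          ∑' p : P, q p.1.1 p.1.2) P ⟨hPc, fun p hp => ⟨(hP p hp).2.2.1,
            (hP p hp).2.1.2.2.le.trans (min_le_left _ _), (hP p hp).2.2.2⟩, hPd⟩ le_rfl
      refine le_trans ?_ hPq
      calc ENNReal.ofReal (1 / (γ' * C)) * μ U
          = ENNReal.ofReal (1 / (γ' * C)) * μ.restrict U U := by rw [Measure.restrict_apply_self]
        _ ≤ ENNReal.ofReal (1 / (γ' * C)) * μ.restrict U (⋃ p ∈ P, closedBall p.1 p.2) := by
            gcongr 1
            refine measure_mono_ae (ae_le_set.2 (measure_mono_null ?_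
              (measure_union_null hnull hP0)))
            rintro x ⟨hx, hx'⟩
            by_cases h : x ∈ s
            · exact Or.inr ⟨h, hx'⟩
            · exact Or.inl ⟨hx, fun h' => h ⟨hx, h'⟩⟩
        _ ≤ ENNReal.ofReal (1 / (γ' * C)) * ∑' p : P, μ.restrict U (closedBall p.1.1 p.1.2) := by
            gcongr
            exact measure_biUnion_le _ hPc _
        _ = ∑' p : P, ENNReal.ofReal (1 / (γ' * C)) * μ.restrict U (closedBall p.1.1 p.1.2) :=
            ENNReal.tsum_mul_left.symm
        _ ≤ ∑' p : P, q p.1.1 p.1.2 := ENNReal.tsum_le_tsum fun p => by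
            obtain ⟨-, ⟨h1, h2⟩, h3, -⟩ := hP p p.2
            refine le_trans ?_ (hq₁ _ _ h3 (h2.2.trans_le (min_le_right _ _)))
            calc ENNReal.ofReal (1 / (γ' * C)) * μ.restrict U (closedBall p.1.1 p.1.2)
                ≤ ENNReal.ofReal (1 / (γ' * C)) *
                  (ENNReal.ofReal γ' * μ (closedBall p.1.1 (α * p.1.2))) := by
                    gcongr
                    exact (Measure.restrict_apply_le _ _).trans h1
              _ = ENNReal.ofReal (1 / C) * μ (closedBall p.1.1 (α * p.1.2)) := by
                    rw [← mul_assoc, ← ENNReal.ofReal_mul (by positivity)]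
                    congr 2
                    field_simp
    have hlim : Tendsto (fun γ' : ℝ => ENNReal.ofReal (1 / (γ' * C)) * μ U) (𝓝[>] γ)
        (𝓝 (ENNReal.ofReal (1 / (γ * C)) * μ U)) := by
      refine ENNReal.Tendsto.mul_const (ENNReal.tendsto_ofReal ?_) (Or.inl ?_)
      · have : ContinuousAt (fun γ' : ℝ => 1 / (γ' * C)) γ :=
          continuousAt_const.div (by fun_prop) (by positivity)
        exact this.tendsto.mono_left nhdsWithin_le_nhds
      · have : 0 < 1 / (γ * C) := by positivity
        simpa using this
    exact le_of_tendsto hlim (by filter_upwards [self_mem_nhdsWithin] with γ' h using hle γ' h)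
  · push Not at hfin
    obtain ⟨x, hx, hxt⟩ := hfin
    obtain ⟨ε, hε, hεU⟩ := nhds_basis_closedBall.mem_iff.1 (hU.mem_nhds hx)
    set r := min ε (min δ (r₀ / 2))
    have hr0 : 0 < r := lt_min hε (lt_min hδ (half_pos hr₀))
    have hrδ : r ≤ δ := (min_le_right _ _).trans (min_le_left _ _)
    have hrr : r < r₀ := ((min_le_right _ _).trans (min_le_right _ _)).trans_lt (half_lt_self hr₀)
    have hq : q x r = ∞ := by
      refine top_le_iff.1 (le_trans ?_ (hq₁ x r hr0 hrr))
      rw [hxt _ (mul_pos hα hr0), ENNReal.mul_top (by simpa using hC0)]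
    have hP : IsPackingOf U δ {(x, r)} := ⟨countable_singleton _, by
      rintro _ rfl
      exact ⟨hr0, hrδ, (closedBall_subset_closedBall (min_le_left _ _)).trans hεU⟩,
      pairwise_singleton _ _⟩
    refine le_top.trans (le_iSup₂_of_le (f := fun (P : Set (X × ℝ)) (_ : IsPackingOf U δ P) =>
          ∑' p : P, q p.1.1 p.1.2) _ hP ?_)
    rw [tsum_singleton (x, r) (fun p : X × ℝ => q p.1 p.2), hq]

section Packing

variable {X : Type*} [MetricSpace X] {q : X → ℝ → ℝ≥0∞}

theorem IsPackingOf.subset {U V : Set X} {δ δ' : ℝ} {P P' : Set (X × ℝ)} (h : IsPackingOf U δ P)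
    (hδ : δ ≤ δ') (hP : P' ⊆ P) (hV : ∀ p ∈ P', closedBall p.1 p.2 ⊆ V) : IsPackingOf V δ' P' :=
  ⟨h.1.mono hP, fun p hp => ⟨(h.2.1 p (hP hp)).1, (h.2.1 p (hP hp)).2.1.trans hδ, hV p hp⟩,
    h.2.2.mono hP⟩

theorem IsPackingOf.tsum_le_packPre {U : Set X} {δ : ℝ} {P : Set (X × ℝ)}
    (h : IsPackingOf U δ P) : ∑' p : P, q p.1.1 p.1.2 ≤ packPre q δ U :=
  le_iSup₂_of_le (f := fun (P : Set (X × ℝ)) (_ : IsPackingOf U δ P) =>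
    ∑' p : P, q p.1.1 p.1.2) P h le_rfl

theorem packPre_mono {U V : Set X} {δ δ' : ℝ} (hUV : U ⊆ V) (hδ : δ ≤ δ') :
    packPre q δ U ≤ packPre q δ' V :=
  iSup₂_le fun _ hP =>
    (hP.subset hδ Subset.rfl fun p hp => (hP.2.1 p hp).2.2.trans hUV).tsum_le_packPre

theorem packOpen_le_packPre {U : Set X} {δ : ℝ} (hδ : 0 < δ) : packOpen q U ≤ packPre q δ U :=
  iInf₂_le δ hδ

theorem packOpen_mono {U V : Set X} (hUV : U ⊆ V) : packOpen q U ≤ packOpen q V :=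
  iInf₂_mono fun _ _ => packPre_mono hUV le_rfl

theorem tendsto_packPre (U : Set X) :
    Tendsto (fun δ => packPre q δ U) (𝓝[>] 0) (𝓝 (packOpen q U)) := by
  refine tendsto_order.2 ⟨fun a ha => ?_, fun a ha => ?_⟩
  · filter_upwards [self_mem_nhdsWithin] with δ hδ using ha.trans_le (packOpen_le_packPre hδ)
  · simp only [packOpen, iInf_lt_iff] at ha
    obtain ⟨δ, hδ, h⟩ := ha
    filter_upwards [Ioo_mem_nhdsGT hδ] with δ' hδ'
    exact (packPre_mono Subset.rfl hδ'.2.le).trans_lt h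

theorem packOpen_empty : packOpen q (∅ : Set X) = 0 := by
  refine nonpos_iff_eq_zero.1 ((packOpen_le_packPre one_pos).trans (iSup₂_le fun P hP => ?_))
  have : P = ∅ := eq_empty_of_forall_notMem fun p hp =>
    (hP.2.1 p hp).2.2 (mem_closedBall_self (hP.2.1 p hp).1.le)
  subst this
  simp

theorem packPre_add_le {U V W : Set X} {δ : ℝ} (hUV : Disjoint U V) (hU : U ⊆ W) (hV : V ⊆ W) :
    packPre q δ U + packPre q δ V ≤ packPre q δ W := by
  have hne : ∀ U : Set X, ∃ P, IsPackingOf U δ P := fun U =>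
    ⟨∅, countable_empty, by simp, by simp⟩
  refine ENNReal.biSup_add_biSup_le' (hne U) (hne V) fun P hP P' hP' => ?_
  have hd : Disjoint P P' := Set.disjoint_left.2 fun p hp hp' =>
    Set.disjoint_left.1 hUV ((hP.2.1 p hp).2.2 (mem_closedBall_self (hP.2.1 p hp).1.le))
      ((hP'.2.1 p hp').2.2 (mem_closedBall_self (hP.2.1 p hp).1.le))
  rw [← Summable.tsum_union_disjoint (f := fun p : X × ℝ => q p.1 p.2) hd ENNReal.summable
    ENNReal.summable]
  refine IsPackingOf.tsum_le_packPre ⟨hP.1.union hP'.1, ?_, ?_⟩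
  · rintro p (hp | hp)
    · exact ⟨(hP.2.1 p hp).1, (hP.2.1 p hp).2.1, (hP.2.1 p hp).2.2.trans hU⟩
    · exact ⟨(hP'.2.1 p hp).1, (hP'.2.1 p hp).2.1, (hP'.2.1 p hp).2.2.trans hV⟩
  · rintro p (hp | hp) p' (hp' | hp') hne
    · exact hP.2.2 hp hp' hne
    · exact hUV.mono (hP.2.1 p hp).2.2 (hP'.2.1 p' hp').2.2
    · exact (hUV.mono (hP.2.1 p' hp').2.2 (hP'.2.1 p hp).2.2).symm
    · exact hP'.2.2 hp hp' hne

theorem packOpen_add_le {U V W : Set X} (hUV : Disjoint U V) (hU : U ⊆ W) (hV : V ⊆ W) :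
    packOpen q U + packOpen q V ≤ packOpen q W :=
  le_iInf₂ fun _ hδ => (add_le_add (packOpen_le_packPre hδ) (packOpen_le_packPre hδ)).trans
    (packPre_add_le hUV hU hV)

theorem packM_union_of_separated {E F : Set X} {ε : ℝ} (hε : 0 < ε)
    (hle : packM q (E ∪ F) ≤ packM q E + packM q F)
    (h : ∀ x ∈ E, ∀ y ∈ F, ε ≤ dist x y) : packM q (E ∪ F) = packM q E + packM q F := by
  refine hle.antisymm (le_iInf₂ fun W hW => le_iInf fun hEF => ?_)
  have hd : Disjoint (thickening (ε / 2) E) (thickening (ε / 2) F) := by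
    refine Set.disjoint_left.2 fun x hx hx' => ?_
    obtain ⟨e, he, hxe⟩ := mem_thickening_iff.1 hx
    obtain ⟨f, hf, hxf⟩ := mem_thickening_iff.1 hx'
    linarith [h e he f hf, dist_triangle_left e f x]
  have hM : ∀ G ⊆ W, packM q G ≤ packOpen q (W ∩ thickening (ε / 2) G) := fun G hG =>
    iInf₂_le_of_le _ (hW.inter isOpen_thickening) (iInf_le _
      (subset_inter hG (self_subset_thickening (half_pos hε) G)))
  exact (add_le_add (hM E (subset_union_left.trans hEF)) (hM F (subset_union_right.trans hEF))).trans
    (packOpen_add_le (hd.mono inter_subset_right inter_subset_right) inter_subset_left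
      inter_subset_left)

variable [MeasurableSpace X] [BorelSpace X] {μ : Measure X} {C r₀ : ℝ}

theorem IsPackingOf.tsum_le_measure
    (hq : ∀ (x : X) (r : ℝ), 0 < r → r < r₀ → q x r ≤ ENNReal.ofReal C * μ (closedBall x r))
    {U : Set X} {δ : ℝ} (hδ : δ < r₀) {P : Set (X × ℝ)} (hP : IsPackingOf U δ P) :
    ∑' p : P, q p.1.1 p.1.2 ≤ ENNReal.ofReal C * μ U :=
  calc ∑' p : P, q p.1.1 p.1.2
      ≤ ∑' p : P, ENNReal.ofReal C * μ (closedBall p.1.1 p.1.2) := ENNReal.tsum_le_tsum fun p =>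
        hq _ _ (hP.2.1 p p.2).1 ((hP.2.1 p p.2).2.1.trans_lt hδ)
    _ = ENNReal.ofReal C * ∑' p : P, μ (closedBall p.1.1 p.1.2) := ENNReal.tsum_mul_left
    _ ≤ ENNReal.ofReal C * μ U := by
        gcongr
        exact tsum_measure_closedBall_le μ hP.1 (fun p hp => (hP.2.1 p hp).2.2) hP.2.2

theorem packOpen_le_measure (hr₀ : 0 < r₀)
    (hq : ∀ (x : X) (r : ℝ), 0 < r → r < r₀ → q x r ≤ ENNReal.ofReal C * μ (closedBall x r))
    (U : Set X) : packOpen q U ≤ ENNReal.ofReal C * μ U :=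
  (packOpen_le_packPre (half_pos hr₀)).trans
    (iSup₂_le fun _ hP => hP.tsum_le_measure hq (half_lt_self hr₀))

/-- The packing premeasure of a union: the balls contained in none of the two sets stay close to
both complements. -/
theorem packPre_union_le
    (hq : ∀ (x : X) (r : ℝ), 0 < r → r < r₀ → q x r ≤ ENNReal.ofReal C * μ (closedBall x r))
    (U V : Set X) {δ : ℝ} (hδ : δ < r₀) :
    packPre q δ (U ∪ V) ≤ packPre q δ U + packPre q δ V + ENNReal.ofReal C *
      μ ((U ∪ V) ∩ (cthickening (2 * δ) Uᶜ ∩ cthickening (2 * δ) Vᶜ)) := by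
  refine iSup₂_le fun P hP => ?_
  set F := (U ∪ V) ∩ (cthickening (2 * δ) Uᶜ ∩ cthickening (2 * δ) Vᶜ)
  let Q : Set X → Set (X × ℝ) := fun W => {p ∈ P | closedBall p.1 p.2 ⊆ W}
  have hQ : ∀ W, IsPackingOf W δ (Q W) := fun W =>
    hP.subset le_rfl (sep_subset _ _) fun p hp => hp.2
  have hthick : ∀ W : Set X, ∀ p ∈ P, ¬ closedBall p.1 p.2 ⊆ W →
      closedBall p.1 p.2 ⊆ cthickening (2 * δ) Wᶜ := by
    intro W p hp hW z hz
    obtain ⟨y, hy, hyW⟩ := not_subset.1 hW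
    refine mem_cthickening_of_dist_le z y _ _ hyW ?_
    rw [mem_closedBall] at hy hz
    linarith [dist_triangle_right z y p.1, (hP.2.1 p hp).2.1]
  have hsub : P ⊆ (Q U ∪ Q V) ∪ Q F := by
    intro p hp
    by_cases hU : closedBall p.1 p.2 ⊆ U
    · exact Or.inl (Or.inl ⟨hp, hU⟩)
    by_cases hV : closedBall p.1 p.2 ⊆ V
    · exact Or.inl (Or.inr ⟨hp, hV⟩)
    exact Or.inr ⟨hp, subset_inter (hP.2.1 p hp).2.2
      (subset_inter (hthick U p hp hU) (hthick V p hp hV))⟩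
  calc ∑' p : P, q p.1.1 p.1.2
      ≤ ∑' p : ↑((Q U ∪ Q V) ∪ Q F), q p.1.1 p.1.2 :=
        ENNReal.tsum_mono_subtype (fun p : X × ℝ => q p.1 p.2) hsub
    _ ≤ ∑' p : ↑(Q U ∪ Q V), q p.1.1 p.1.2 + ∑' p : Q F, q p.1.1 p.1.2 :=
        ENNReal.tsum_union_le (fun p : X × ℝ => q p.1 p.2) _ _
    _ ≤ (∑' p : Q U, q p.1.1 p.1.2 + ∑' p : Q V, q p.1.1 p.1.2) + ∑' p : Q F, q p.1.1 p.1.2 := by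
        gcongr
        exact ENNReal.tsum_union_le (fun p : X × ℝ => q p.1 p.2) _ _
    _ ≤ _ := add_le_add (add_le_add (hQ U).tsum_le_packPre (hQ V).tsum_le_packPre)
        ((hQ F).tsum_le_measure hq hδ)

variable {c : ℝ≥0∞}

theorem packOpen_union_le (hr₀ : 0 < r₀)
    (hq : ∀ (x : X) (r : ℝ), 0 < r → r < r₀ → q x r ≤ ENNReal.ofReal C * μ (closedBall x r))
    (hc : c ≠ 0) (hlow : ∀ U : Set X, IsOpen U → c * μ U ≤ packOpen q U)
    {U V : Set X} (hU : IsOpen U) (hV : IsOpen V) :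
    packOpen q (U ∪ V) ≤ packOpen q U + packOpen q V := by
  by_cases htop : μ (U ∪ V) = ∞
  · calc packOpen q (U ∪ V) ≤ c * μ (U ∪ V) := by rw [htop, ENNReal.mul_top hc]; exact le_top
      _ ≤ c * (μ U + μ V) := by gcongr; exact measure_union_le _ _
      _ ≤ packOpen q U + packOpen q V := by
        rw [mul_add]; exact add_le_add (hlow U hU) (hlow V hV)
  let F : ℝ → Set X := fun δ => (U ∪ V) ∩ (cthickening (2 * δ) Uᶜ ∩ cthickening (2 * δ) Vᶜ)
  have hF : Tendsto (μ ∘ F) (𝓝[>] 0) (𝓝 (μ (⋂ δ > 0, F δ))) := by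
    refine tendsto_measure_biInter_gt (fun δ _ => ?_) (fun i j _ hij => ?_)
      ⟨1, one_pos, ne_top_of_le_ne_top htop (measure_mono inter_subset_left)⟩
    · exact ((hU.union hV).measurableSet.inter (isClosed_cthickening.measurableSet.inter
        isClosed_cthickening.measurableSet)).nullMeasurableSet
    · exact inter_subset_inter_right _ (inter_subset_inter (cthickening_mono (by linarith) _)
        (cthickening_mono (by linarith) _))
  have hF0 : ⋂ δ > 0, F δ = ∅ := by
    have hcl : ∀ W : Set X, IsOpen W → ∀ x, (∀ δ > 0, x ∈ cthickening (2 * δ) Wᶜ) → x ∉ W := by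
      intro W hW x hx
      have : x ∈ closure Wᶜ := by
        rw [closure_eq_iInter_cthickening]
        simp only [mem_iInter]
        intro δ hδ
        have := hx (δ / 2) (half_pos hδ)
        rwa [mul_div_cancel₀ δ two_ne_zero] at this
      rwa [hW.isClosed_compl.closure_eq] at this
    refine eq_empty_of_forall_notMem fun x hx => ?_
    simp only [mem_iInter] at hx
    exact (hx 1 one_pos).1.elim (hcl U hU x fun δ hδ => (hx δ hδ).2.1)
      (hcl V hV x fun δ hδ => (hx δ hδ).2.2)
  rw [hF0, measure_empty] at hF
  have hlim := ((tendsto_packPre (q := q) U).add (tendsto_packPre (q := q) V)).add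
    (ENNReal.Tendsto.const_mul hF (Or.inr (ENNReal.ofReal_ne_top (r := C))))
  rw [mul_zero, add_zero] at hlim
  refine ge_of_tendsto hlim ?_
  filter_upwards [Ioo_mem_nhdsGT hr₀] with δ hδ
  exact (packOpen_le_packPre hδ.1).trans (packPre_union_le hq U V hδ.2)

theorem packOpen_iUnion_le (hr₀ : 0 < r₀)
    (hq : ∀ (x : X) (r : ℝ), 0 < r → r < r₀ → q x r ≤ ENNReal.ofReal C * μ (closedBall x r))
    (hc : c ≠ 0) (hlow : ∀ U : Set X, IsOpen U → c * μ U ≤ packOpen q U)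
    {U : ℕ → Set X} (hU : ∀ n, IsOpen (U n)) :
    packOpen q (⋃ n, U n) ≤ ∑' n, packOpen q (U n) := by
  by_cases htop : ∑' n, μ (U n) = ∞
  · calc packOpen q (⋃ n, U n) ≤ c * ∑' n, μ (U n) := by
          rw [htop, ENNReal.mul_top hc]; exact le_top
      _ = ∑' n, c * μ (U n) := ENNReal.tsum_mul_left.symm
      _ ≤ ∑' n, packOpen q (U n) := ENNReal.tsum_le_tsum fun n => hlow _ (hU n)
  have hfin : ∀ N, packOpen q (⋃ n ∈ Finset.range N, U n) ≤
      ∑ n ∈ Finset.range N, packOpen q (U n) := by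
    intro N
    induction N with
    | zero => simp [packOpen_empty]
    | succ N ih =>
      rw [Finset.sum_range_succ, Finset.range_add_one, Finset.set_biUnion_insert, union_comm]
      exact (packOpen_union_le hr₀ hq hc hlow (isOpen_biUnion fun n _ => hU n) (hU N)).trans
        (add_le_add_left ih _)
  have hlim := (ENNReal.Tendsto.const_mul (a := ENNReal.ofReal C)
    (ENNReal.tendsto_sum_nat_add (fun n => μ (U n)) htop)
    (Or.inr ENNReal.ofReal_ne_top)).const_add (∑' n, packOpen q (U n))
  rw [mul_zero, add_zero] at hlim
  refine ge_of_tendsto hlim (Eventually.of_forall fun N => ?_)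
  have hsplit : ⋃ n, U n ⊆ (⋃ n ∈ Finset.range N, U n) ∪ ⋃ n, U (n + N) := by
    refine iUnion_subset fun n => ?_
    by_cases hn : n < N
    · exact (subset_biUnion_of_mem (u := U) (Finset.mem_range.2 hn)).trans subset_union_left
    · obtain ⟨k, rfl⟩ := Nat.exists_eq_add_of_le' (not_lt.1 hn)
      exact (subset_iUnion (fun n => U (n + N)) k).trans subset_union_right
  calc packOpen q (⋃ n, U n)
      ≤ packOpen q ((⋃ n ∈ Finset.range N, U n) ∪ ⋃ n, U (n + N)) := packOpen_mono hsplit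
    _ ≤ packOpen q (⋃ n ∈ Finset.range N, U n) + packOpen q (⋃ n, U (n + N)) :=
        packOpen_union_le hr₀ hq hc hlow (isOpen_biUnion fun n _ => hU n)
          (isOpen_iUnion fun n => hU _)
    _ ≤ ∑' n, packOpen q (U n) + ENNReal.ofReal C * ∑' n, μ (U (n + N)) := by
        refine add_le_add ((hfin N).trans (ENNReal.sum_le_tsum _))
          ((packOpen_le_measure hr₀ hq _).trans ?_)
        gcongr
        exact measure_iUnion_le _

/-- The packing construction as an outer measure. -/
theorem exists_outerMeasure_eq_packM (hr₀ : 0 < r₀)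
    (hq : ∀ (x : X) (r : ℝ), 0 < r → r < r₀ → q x r ≤ ENNReal.ofReal C * μ (closedBall x r))
    (hc : c ≠ 0) (hlow : ∀ U : Set X, IsOpen U → c * μ U ≤ packOpen q U) :
    ∃ m : OuterMeasure X, ∀ A, m A = packM q A :=
  ⟨inducedOuterMeasure (fun U (_ : IsOpen U) => packOpen q U) isOpen_empty packOpen_empty,
    fun A => inducedOuterMeasure_eq_iInf (fun _ => isOpen_iUnion)
      (fun _ hU => packOpen_iUnion_le hr₀ hq hc hlow hU) (fun _ _ _ _ h => packOpen_mono h) A⟩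

end Packing

/-- main theorem: under Hypothesis 1 and the two-sided bound
`C⁻¹ μ(B_{αr}(x)) ≤ q(B_r(x)) ≤ C μ(B_r(x))` for `0 < r < r₀`:
(1) `(1/(γC)) μ(A) ≤ ĥμ^q(A) ≤ C inf{μ(U) : A ⊆ U open}` for Borel `A`;
(2) `ĥμ^q` is a countably sub-additive metric outer measure and every Borel set is
`ĥμ^q`-measurable in the Carathéodory sense;
(3) if `μ` is outer regular then `(1/(γC)) μ ≤ ĥμ^q ≤ C μ`, so `ĥμ^q` is equivalent to `μ`. -/
theorem stmt16 {X : Type*} [MetricSpace X] [MeasurableSpace X] [BorelSpace X]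
    [TopologicalSpace.SeparableSpace X]
    (ξ η : ℝ) (ζ : ℕ) (hξ : 0 < ξ) (hη : 0 < η) (hη' : η ≤ 1/3) (hζ : 0 < ζ)
    (hdir : DirLimited (Set.univ : Set X) ξ η ζ)
    (ν : Measure X) (α γ : ℝ) (hα : 0 < α) (hα1 : α ≤ 1) (hγ : 1 ≤ γ)
    (hν : AsympBounded ν α γ)
    (μ : Measure X) (q : X → ℝ → ℝ≥0∞) (C r₀ : ℝ) (hC : 1 ≤ C) (hr₀ : 0 < r₀)
    (hq₁ : ∀ (x : X) (r : ℝ), 0 < r → r < r₀ →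
      ENNReal.ofReal (1 / C) * μ (Metric.closedBall x (α * r)) ≤ q x r)
    (hq₂ : ∀ (x : X) (r : ℝ), 0 < r → r < r₀ →
      q x r ≤ ENNReal.ofReal C * μ (Metric.closedBall x r)) :
    -- (1) two-sided comparison with μ
    (∀ A : Set X, MeasurableSet A →
      ENNReal.ofReal (1 / (γ * C)) * μ A ≤ packM q A ∧
      packM q A ≤ ENNReal.ofReal C * ⨅ (U : Set X) (_ : IsOpen U) (_ : A ⊆ U), μ U) ∧
    -- (2) ĥμ^q is a countably sub-additive metric outer measure …
    (packM q (∅ : Set X) = 0 ∧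
      (∀ A B : Set X, A ⊆ B → packM q A ≤ packM q B) ∧
      (∀ A : ℕ → Set X, packM q (⋃ n, A n) ≤ ∑' n, packM q (A n)) ∧
      (∀ E F : Set X, (∃ ε : ℝ, 0 < ε ∧ ∀ x ∈ E, ∀ y ∈ F, ε ≤ dist x y) →
        packM q (E ∪ F) = packM q E + packM q F) ∧
      -- … so every Borel set is Carathéodory-measurable for ĥμ^q
      (∀ A : Set X, MeasurableSet A →
        ∀ E : Set X, packM q E = packM q (E ∩ A) + packM q (E \ A))) ∧
    -- (3) with outer regularity, equivalence with μ
    (μ.OuterRegular → ∀ A : Set X, MeasurableSet A →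
      ENNReal.ofReal (1 / (γ * C)) * μ A ≤ packM q A ∧
      packM q A ≤ ENNReal.ofReal C * μ A) := by
  have : SecondCountableTopology X := UniformSpace.secondCountable_of_separable X
  have hX : ∀ x : X, HasBesicovitchCovering (ball x (ξ / 2)) := fun x =>
    hdir.hasBesicovitchCovering hη' fun y hy z hz => by
      rw [mem_ball] at hy hz
      linarith [dist_triangle_right y z x]
  have hlow : ∀ U : Set X, IsOpen U → ENNReal.ofReal (1 / (γ * C)) * μ U ≤ packOpen q U :=
    fun U hU => le_iInf₂ fun δ hδ =>
      ofReal_mul_measure_le_packPre (half_pos hξ) hX hα hα1 hγ hν hC hr₀ hq₁ hU hδ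
  have hc : ENNReal.ofReal (1 / (γ * C)) ≠ 0 := by
    have : 0 < 1 / (γ * C) := by positivity
    simpa using this
  obtain ⟨m, hm⟩ := exists_outerMeasure_eq_packM hr₀ hq₂ hc hlow
  have hle : ∀ A : Set X, ENNReal.ofReal (1 / (γ * C)) * μ A ≤ packM q A := fun A =>
    le_iInf₂ fun U hU => le_iInf fun hAU =>
      (mul_le_mul_right (measure_mono hAU) _).trans (hlow U hU)
  have hge : ∀ A : Set X, packM q A ≤
      ENNReal.ofReal C * ⨅ (U : Set X) (_ : IsOpen U) (_ : A ⊆ U), μ U := fun A => by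
    have hC0 : ENNReal.ofReal C ≠ 0 := by
      have : 0 < C := by linarith
      simpa using this
    simp only [ENNReal.mul_iInf_of_ne hC0 ENNReal.ofReal_ne_top]
    exact iInf_mono fun U => iInf_mono fun hU => iInf_mono fun hA =>
      packOpen_le_measure hr₀ hq₂ U
  have hsep : ∀ E F : Set X, (∃ ε : ℝ, 0 < ε ∧ ∀ x ∈ E, ∀ y ∈ F, ε ≤ dist x y) →
      packM q (E ∪ F) = packM q E + packM q F := fun E F ⟨ε, hε, h⟩ =>
    packM_union_of_separated hε (by simpa only [hm] using measure_union_le (μ := m) E F) h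
  have hmetric : m.IsMetric := by
    rintro E F ⟨r, hr, h⟩
    simp only [hm]
    have hr1 : min r 1 ≠ ∞ := ne_top_of_le_ne_top ENNReal.one_ne_top (min_le_right _ _)
    refine hsep E F ⟨(min r 1).toReal, ENNReal.toReal_pos ?_ hr1, fun x hx y hy => ?_⟩
    · simp [hr, min_eq_iff]
    · refine ENNReal.toReal_le_of_le_ofReal dist_nonneg ?_
      rw [← edist_dist]
      exact (min_le_left _ _).trans (h x hx y hy)
  refine ⟨fun A _ => ⟨hle A, hge A⟩, ⟨?_, fun A B h => ?_, fun A => ?_, hsep, fun A hA E => ?_⟩,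
    fun _ A _ => ⟨hle A, (hge A).trans_eq ?_⟩⟩
  · rw [← hm, measure_empty]
  · simpa only [hm] using measure_mono (μ := m) h
  · simpa only [hm] using measure_iUnion_le (μ := m) A
  · have hA' : MeasurableSet[m.caratheodory] A :=
      hmetric.borel_le_caratheodory A (BorelSpace.measurable_eq (α := X) ▸ hA)
    simpa only [hm] using OuterMeasure.isCaratheodory_iff m |>.1 hA' E
  · rw [A.measure_eq_iInf_isOpen μ]
    simp only [iInf_comm (ι := IsOpen _)]
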